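/- For every integer s ≥ 1, 2(1 - 2^{1-2s}) ζ(2s) = ζ*({2}^s), where ζ*({2}^s) is the multiple zeta-star value with s entries equal to 2. -/

import Mathlib

open scoped BigOperators

/-- Multiple zeta-star value ζ*, encoded with mᵢ = m i + 1. -/
noncomputable def zetaStar {n : ℕ} (k : Fin n → ℕ) : ℝ :=
  ∑' m : Fin n → ℕ, if Monotone m then ∏ i, (1 : ℝ) / ((m i + 1 : ℝ) ^ (k i)) else 0

open Finset Filter Topology

/-- The ratio `(N!)² / ((N - k)! (N + k)!)`, which vanishes for `k > N`. -/
noncomputable def centralRatio (N k : ℕ) : ℝ :=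
  ∏ j ∈ range k, ((N : ℝ) - j) / (N + j + 1)

theorem centralRatio_succ (N k : ℕ) :
    centralRatio N (k + 1) = centralRatio N k * (((N : ℝ) - k) / (N + k + 1)) :=
  prod_range_succ _ _

theorem centralRatio_eq_zero {N k : ℕ} (h : N < k) : centralRatio N k = 0 :=
  prod_eq_zero (mem_range.2 h) (by simp)

theorem abs_centralRatio_le_one (N k : ℕ) : |centralRatio N k| ≤ 1 := by
  rw [centralRatio, abs_prod]
  refine prod_le_one (fun _ _ => abs_nonneg _) fun j _ => ?_
  have hpos : (0 : ℝ) < N + j + 1 := by positivity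
  rw [abs_div, abs_of_pos hpos, div_le_one hpos, abs_le]
  constructor <;> linarith [Nat.cast_nonneg (α := ℝ) N, Nat.cast_nonneg (α := ℝ) j]

theorem tendsto_centralRatio (k : ℕ) :
    Tendsto (fun N => centralRatio N k) atTop (𝓝 1) := by
  have hfactor (j : ℕ) :
      Tendsto (fun N : ℕ => ((N : ℝ) - j) / (N + j + 1)) atTop (𝓝 1) := by
    have hlim : Tendsto (fun N : ℕ => 1 - (2 * j + 1 : ℝ) / (N + (j + 1))) atTop (𝓝 (1 - 0)) :=
      tendsto_const_nhds.sub <| Tendsto.div_atTop tendsto_const_nhds <|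
        tendsto_atTop_add_const_right _ _ tendsto_natCast_atTop_atTop
    rw [sub_zero] at hlim
    refine hlim.congr fun N => ?_
    have hpos : (0 : ℝ) < N + j + 1 := by positivity
    have hpos' : (0 : ℝ) < N + (j + 1) := by positivity
    field_simp
    ring
  simpa [centralRatio] using tendsto_finsetProd (range k) fun j _ => hfactor j

theorem centralRatio_succ_left (N k : ℕ) :
    centralRatio (N + 1) k * (((N : ℝ) + 1) ^ 2 - k ^ 2) = centralRatio N k * (N + 1) ^ 2 := by
  induction k with
  | zero => simp [centralRatio]
  | succ k ih =>
    rw [centralRatio_succ, centralRatio_succ]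
    have h₁ : (N : ℝ) + k + 1 ≠ 0 := by positivity
    have h₂ : (N : ℝ) + 1 + k + 1 ≠ 0 := by positivity
    push_cast
    field_simp
    linear_combination ((N : ℝ) - k) * (N + 1 + k + 1) * ih

theorem sum_alternating_centralRatio {N : ℕ} (hN : N ≠ 0) (K : ℕ) :
    ∑ k ∈ range K, 2 * (-1) ^ k * centralRatio N (k + 1) =
      1 - (-1) ^ K * centralRatio N K * ((N - K) / N) := by
  have hN' : (N : ℝ) ≠ 0 := Nat.cast_ne_zero.2 hN
  induction K with
  | zero => simp [centralRatio, hN']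
  | succ K ih =>
    rw [sum_range_succ, ih, centralRatio_succ]
    have h₁ : (N : ℝ) + K + 1 ≠ 0 := by positivity
    push_cast
    field_simp
    ring

/-- The truncation of `ζ*({2}^s)` to indices at most `N`, defined by summing over the largest
index first. -/
noncomputable def zetaStarTwoTrunc : ℕ → ℕ → ℝ
  | 0, _ => 1
  | s + 1, N => ∑ j ∈ range N, zetaStarTwoTrunc s (j + 1) * (1 / ((j : ℝ) + 1) ^ 2)

/-- The finite alternating sum which the partial fraction expansion of
`∏ (1 - x / k ^ 2)⁻¹` yields for the truncated multiple zeta-star value. -/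
noncomputable def alternatingTrunc (s N : ℕ) : ℝ :=
  ∑ k ∈ range N, 2 * (-1) ^ k * centralRatio N (k + 1) * (1 / ((k : ℝ) + 1) ^ (2 * s))

theorem alternatingTrunc_succ (s N : ℕ) :
    alternatingTrunc (s + 1) (N + 1) =
      alternatingTrunc (s + 1) N + alternatingTrunc s (N + 1) * (1 / ((N : ℝ) + 1) ^ 2) := by
  have hext : alternatingTrunc (s + 1) N = ∑ k ∈ range (N + 1),
      2 * (-1) ^ k * centralRatio N (k + 1) * (1 / ((k : ℝ) + 1) ^ (2 * (s + 1))) := by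
    rw [sum_range_succ, centralRatio_eq_zero N.lt_succ_self]
    simp [alternatingTrunc]
  rw [hext, alternatingTrunc, alternatingTrunc, sum_mul, ← sum_add_distrib]
  refine sum_congr rfl fun k _ => ?_
  have h := centralRatio_succ_left N (k + 1)
  have h₁ : (N : ℝ) + 1 ≠ 0 := by positivity
  have h₂ : (k : ℝ) + 1 ≠ 0 := by positivity
  push_cast at h
  rw [mul_add, pow_add]
  field_simp
  linear_combination h

theorem zetaStarTwoTrunc_eq_alternatingTrunc (s N : ℕ) (h : s ≠ 0 ∨ N ≠ 0) :
    zetaStarTwoTrunc s N = alternatingTrunc s N := by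
  induction s generalizing N with
  | zero =>
    have := sum_alternating_centralRatio (N := N) (by simpa using h) N
    simp [zetaStarTwoTrunc, alternatingTrunc, this]
  | succ s ih =>
    induction N with
    | zero => simp [zetaStarTwoTrunc, alternatingTrunc]
    | succ N ihN =>
      rw [alternatingTrunc_succ, ← ihN (by simp), ← ih (N + 1) (by simp), zetaStarTwoTrunc,
        sum_range_succ, zetaStarTwoTrunc]

theorem sum_monotone_eq_zetaStarTwoTrunc (s N : ℕ) :
    ∑ m ∈ (Fintype.piFinset fun _ : Fin s => range N) with Monotone m,
      ∏ i, (1 : ℝ) / ((m i + 1 : ℝ) ^ 2) = zetaStarTwoTrunc s N := by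
  induction s generalizing N with
  | zero =>
    rw [filter_true_of_mem fun m _ => Subsingleton.monotone m]
    simp [zetaStarTwoTrunc]
  | succ s ih =>
    simp_rw [zetaStarTwoTrunc, ← ih, sum_mul]
    rw [sum_sigma']
    refine sum_nbij' (fun m => ⟨m (Fin.last s), Fin.init m⟩)
      (fun p => Fin.snoc (α := fun _ => ℕ) p.2 p.1) ?_ ?_ ?_ ?_ ?_
    · intro m hm
      simp only [mem_filter, Fintype.mem_piFinset, mem_range, mem_sigma] at hm ⊢
      exact ⟨hm.1 _, fun i => Nat.lt_succ_of_le (hm.2 (Fin.le_last _)),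
        fun i j hij => hm.2 (Fin.castSucc_le_castSucc_iff.2 hij)⟩
    · rintro ⟨j, m⟩ hm
      simp only [mem_filter, Fintype.mem_piFinset, mem_range, mem_sigma] at hm ⊢
      obtain ⟨hj, hlt, hmono⟩ := hm
      refine ⟨fun i => ?_, ?_⟩
      · induction i using Fin.lastCases with
        | last => simpa using hj
        | cast i => simpa using (hlt i).trans_le hj
      · intro a b
        induction b using Fin.lastCases with
        | last =>
          intro _
          induction a using Fin.lastCases with
          | last => rfl
          | cast a => simpa using Nat.le_of_lt_succ (hlt a)
        | cast b =>
          induction a using Fin.lastCases with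
          | last => exact fun h => absurd h (not_le.2 (Fin.castSucc_lt_last b))
          | cast a => exact fun h => by simpa using hmono (Fin.castSucc_le_castSucc_iff.1 h)
    · intro m _
      exact Fin.snoc_init_self m
    · rintro ⟨j, m⟩ _
      simp
    · intro m _
      rw [Fin.prod_univ_castSucc]
      rfl

theorem summable_one_div_nat_succ_pow {p : ℕ} (hp : 1 < p) :
    Summable fun k : ℕ => 1 / ((k : ℝ) + 1) ^ p := by
  simpa using (summable_nat_add_iff 1).2 (Real.summable_one_div_nat_pow.2 hp)

theorem tendsto_alternatingTrunc {s : ℕ} (hs : 1 ≤ s) :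
    Tendsto (alternatingTrunc s) atTop
      (𝓝 (∑' k : ℕ, 2 * (-1) ^ k * (1 / ((k : ℝ) + 1) ^ (2 * s)))) := by
  have htsum (N : ℕ) : alternatingTrunc s N =
      ∑' k : ℕ, 2 * (-1) ^ k * centralRatio N (k + 1) * (1 / ((k : ℝ) + 1) ^ (2 * s)) := by
    refine (tsum_eq_sum fun k hk => ?_).symm
    rw [centralRatio_eq_zero (by simpa [Nat.lt_succ_iff] using hk)]
    simp
  simp_rw [funext htsum]
  refine tendsto_tsum_of_dominated_convergence
    (bound := fun k : ℕ => 2 * (1 / ((k : ℝ) + 1) ^ (2 * s)))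
    ((summable_one_div_nat_succ_pow (by omega)).mul_left 2) (fun k => ?_)
    (Eventually.of_forall fun N k => ?_)
  · simpa using ((tendsto_centralRatio (k + 1)).const_mul (2 * (-1 : ℝ) ^ k)).mul_const
      (1 / ((k : ℝ) + 1) ^ (2 * s))
  · have hpos : (0 : ℝ) ≤ 1 / ((k : ℝ) + 1) ^ (2 * s) := by positivity
    rw [Real.norm_eq_abs, abs_mul, abs_mul, abs_mul, abs_of_nonneg hpos]
    simp only [abs_pow, abs_neg, abs_one, one_pow, mul_one, Nat.abs_ofNat]
    exact mul_le_mul_of_nonneg_right (by linarith [abs_centralRatio_le_one N (k + 1)]) hpos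

theorem hasSum_of_nonneg_of_tendsto_sum_piFinset_range {ι : Type*} [Fintype ι] [DecidableEq ι]
    {f : (ι → ℕ) → ℝ} (hf : ∀ m, 0 ≤ f m) {L : ℝ}
    (hL : Tendsto (fun N => ∑ m ∈ Fintype.piFinset fun _ : ι => range N, f m) atTop (𝓝 L)) :
    HasSum f L := by
  have hmono : Monotone fun N : ℕ => Fintype.piFinset fun _ : ι => range N :=
    fun a b hab => Fintype.piFinset_subset _ _ fun _ => range_mono hab
  have htop : Tendsto (fun N : ℕ => Fintype.piFinset fun _ : ι => range N) atTop atTop :=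
    tendsto_atTop_finset_of_monotone hmono fun m => ⟨univ.sup m + 1, by
      simpa [Nat.lt_succ_iff] using fun i => le_sup (f := m) (mem_univ i)⟩
  obtain ⟨B, hB⟩ := hL.bddAbove_range
  have hsum : Summable f := summable_of_sum_le hf (c := B) fun u => by
    obtain ⟨N, hN⟩ := (htop.eventually_ge_atTop u).exists
    exact (sum_le_sum_of_subset_of_nonneg hN fun m _ _ => hf m).trans (hB ⟨N, rfl⟩)
  rw [← tendsto_nhds_unique (hsum.hasSum.comp htop) hL]
  exact hsum.hasSum

theorem zetaStar_two_eq_tsum {s : ℕ} (hs : 1 ≤ s) :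
    zetaStar (fun _ : Fin s => 2) = ∑' k : ℕ, 2 * (-1) ^ k * (1 / ((k : ℝ) + 1) ^ (2 * s)) := by
  refine (hasSum_of_nonneg_of_tendsto_sum_piFinset_range (fun m => ?_) ?_).tsum_eq
  · split_ifs <;> positivity
  · refine (tendsto_alternatingTrunc hs).congr fun N => ?_
    rw [← sum_filter, sum_monotone_eq_zetaStarTwoTrunc,
      zetaStarTwoTrunc_eq_alternatingTrunc s N (.inl (by omega))]

theorem tsum_alternating_one_div_nat_succ_pow {p : ℕ} (hp : 1 < p) :
    ∑' k : ℕ, (-1) ^ k * (1 / ((k : ℝ) + 1) ^ p) =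
      (1 - 2 / 2 ^ p) * ∑' k : ℕ, 1 / ((k : ℝ) + 1) ^ p := by
  have hsum := summable_one_div_nat_succ_pow hp
  have heven : Summable fun k : ℕ => 1 / (((2 * k : ℕ) : ℝ) + 1) ^ p :=
    hsum.comp_injective (mul_right_injective₀ two_ne_zero)
  have hodd (k : ℕ) : 1 / (((2 * k + 1 : ℕ) : ℝ) + 1) ^ p =
      1 / 2 ^ p * (1 / ((k : ℝ) + 1) ^ p) := by
    rw [div_mul_div_comm, one_mul, ← mul_pow]
    push_cast
    ring_nf
  have hoddsum : Summable fun k : ℕ => 1 / (((2 * k + 1 : ℕ) : ℝ) + 1) ^ p := by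
    simpa only [hodd] using hsum.mul_left (1 / 2 ^ p)
  have hneg (k : ℕ) : (-1 : ℝ) ^ (2 * k + 1) * (1 / (((2 * k + 1 : ℕ) : ℝ) + 1) ^ p) =
      -(1 / (((2 * k + 1 : ℕ) : ℝ) + 1) ^ p) := by
    rw [Odd.neg_one_pow ⟨k, rfl⟩, neg_one_mul]
  have hpos (k : ℕ) : (-1 : ℝ) ^ (2 * k) * (1 / (((2 * k : ℕ) : ℝ) + 1) ^ p) =
      1 / (((2 * k : ℕ) : ℝ) + 1) ^ p := by
    rw [Even.neg_one_pow (even_two_mul k), one_mul]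
  have hsplit := tsum_even_add_odd (f := fun k : ℕ => 1 / ((k : ℝ) + 1) ^ p) heven hoddsum
  have hsplit' := tsum_even_add_odd (f := fun k : ℕ => (-1) ^ k * (1 / ((k : ℝ) + 1) ^ p))
    (heven.congr fun k => (hpos k).symm) (hoddsum.neg.congr fun k => (hneg k).symm)
  rw [tsum_congr hpos, tsum_congr hneg, tsum_neg, tsum_congr hodd, tsum_mul_left] at hsplit'
  rw [tsum_congr hodd, tsum_mul_left] at hsplit
  rw [← hsplit']
  linear_combination hsplit

theorem riemannZeta_natCast_eq_ofReal_tsum {p : ℕ} (hp : 1 < p) :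
    riemannZeta p = ((∑' k : ℕ, 1 / ((k : ℝ) + 1) ^ p : ℝ) : ℂ) := by
  rw [zeta_eq_tsum_one_div_nat_add_one_cpow (by simpa using hp)]
  push_cast
  simp

theorem stmt11 (s : ℕ) (hs : 1 ≤ s) :
    2 * (1 - (2 : ℂ) ^ ((1 : ℤ) - 2 * s)) * riemannZeta (2 * s)
      = ((zetaStar (fun _ : Fin s => 2) : ℝ) : ℂ) := by
  have hp : 1 < 2 * s := by omega
  have hzeta := riemannZeta_natCast_eq_ofReal_tsum hp
  have hpow : (2 : ℂ) ^ ((1 : ℤ) - 2 * s) = 2 / 2 ^ (2 * s) := by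
    rw [zpow_sub₀ two_ne_zero, zpow_one]
    norm_cast
  push_cast at hzeta
  rw [zetaStar_two_eq_tsum hs, hpow, hzeta]
  simp_rw [mul_assoc]
  rw [tsum_mul_left, tsum_alternating_one_div_nat_succ_pow hp]
  push_cast
  rfl
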